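/- arXiv:1602.04522 — 2 statements merged into one kernel-verified Lean document; each statement's English description precedes it below -/
import Mathlib

section
/- (Jacobian criterion at a rational point.) Let k be a field, let f_1,…,f_s ∈ k[x_1,…,x_n], let I = ⟨f_1,…,f_s⟩, and let p ∈ kⁿ with f_i(p) = 0 for all i. Let A = k[x_1,…,x_n]/I and suppose the localization of A at the maximal ideal m_p/I has Krull dimension n − c. Then this localization is a regular local ring if and only if the s × n Jacobian matrix ((∂f_i/∂x_j)(p)) with entries in k has rank c. -/
open MvPolynomial

/-- The maximal ideal of `k[x_1,…,x_n]` of polynomials vanishing at the point `p`,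
i.e. the kernel of the evaluation map at `p` (equivalently `⟨x_1 - p_1, …, x_n - p_n⟩`). -/
noncomputable def mP {k : Type} [Field k] {n : ℕ} (p : Fin n → k) :
    Ideal (MvPolynomial (Fin n) k) :=
  RingHom.ker (eval p)

theorem mP_isMaximal {k : Type} [Field k] {n : ℕ} (p : Fin n → k) : (mP p).IsMaximal :=
  RingHom.ker_isMaximal_of_surjective _ (fun x => ⟨C x, eval_C x⟩)

/-- For `I ≤ m_p`, the ideal `m_p/I` of the quotient ring is maximal. -/
theorem qP_isMaximal {k : Type} [Field k] {n : ℕ} (p : Fin n → k)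
    (I : Ideal (MvPolynomial (Fin n) k)) (hI : I ≤ mP p) :
    (Ideal.map (Ideal.Quotient.mk I) (mP p)).IsMaximal := by
  rcases Ideal.map_eq_top_or_isMaximal_of_surjective (Ideal.Quotient.mk I)
      Ideal.Quotient.mk_surjective (mP_isMaximal p) with h | h
  · exfalso
    have h2 := congrArg (Ideal.comap (Ideal.Quotient.mk I)) h
    rw [Ideal.comap_map_of_surjective _ Ideal.Quotient.mk_surjective, Ideal.comap_top] at h2
    have hk : Ideal.comap (Ideal.Quotient.mk I) ⊥ = I := by
      simpa [RingHom.ker] using Ideal.mk_ker (I := I)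
    rw [hk, sup_eq_left.mpr hI] at h2
    exact (mP_isMaximal p).ne_top h2
  · exact h

/-- A local ring is regular if its Krull dimension equals the dimension of
its cotangent space `m/m²` over the residue field. -/
def IsRegularLocal (R : Type) [CommRing R] [IsLocalRing R] : Prop :=
  ringKrullDim R =
    (Module.finrank (IsLocalRing.ResidueField R) (IsLocalRing.CotangentSpace R) : WithBot ℕ∞)


/-- Gradient at `p`, as a `k`-linear map. -/
noncomputable def gradAt {k : Type} [Field k] {n : ℕ} (p : Fin n → k) :
    MvPolynomial (Fin n) k →ₗ[k] (Fin n → k) :=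
  LinearMap.pi fun j => (aeval p).toLinearMap ∘ₗ (pderiv j).toLinearMap

theorem gradAt_apply {k : Type} [Field k] {n : ℕ} (p : Fin n → k)
    (g : MvPolynomial (Fin n) k) (j : Fin n) : gradAt p g j = eval p (pderiv j g) := by
  simp [gradAt, aeval_eq_eval]

theorem gradAt_mul {k : Type} [Field k] {n : ℕ} (p : Fin n → k)
    (g h : MvPolynomial (Fin n) k) :
    gradAt p (g * h) = eval p g • gradAt p h + eval p h • gradAt p g := by
  ext j
  simp [gradAt_apply, Derivation.leibniz]

/-- The linear form `∑ a_j (x_j - p_j)`. -/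
noncomputable def linAt {k : Type} [Field k] {n : ℕ} (p : Fin n → k) :
    (Fin n → k) →ₗ[k] MvPolynomial (Fin n) k :=
  Fintype.linearCombination k fun j => (X j - C (p j))

theorem linAt_apply {k : Type} [Field k] {n : ℕ} (p a : Fin n → k) :
    linAt p a = ∑ j, C (a j) * (X j - C (p j)) := by
  simp [linAt, Fintype.linearCombination_apply, smul_eq_C_mul]

theorem linAt_single {k : Type} [Field k] {n : ℕ} (p : Fin n → k) (j : Fin n) :
    linAt p (Pi.single j 1) = X j - C (p j) := by
  simp [linAt]

theorem mem_mP {k : Type} [Field k] {n : ℕ} {p : Fin n → k} {g : MvPolynomial (Fin n) k} :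
    g ∈ mP p ↔ eval p g = 0 := RingHom.mem_ker

theorem linAt_mem {k : Type} [Field k] {n : ℕ} (p a : Fin n → k) :
    linAt p a ∈ mP p := by
  simp [mem_mP, linAt_apply]

theorem gradAt_linAt {k : Type} [Field k] {n : ℕ} (p a : Fin n → k) :
    gradAt p (linAt p a) = a := by
  ext i
  simp [gradAt_apply, linAt_apply, Derivation.leibniz, pderiv_X, Pi.single_apply]

theorem gradAt_sq {k : Type} [Field k] {n : ℕ} (p : Fin n → k)
    (g : MvPolynomial (Fin n) k) (hg : g ∈ mP p ^ 2) : gradAt p g = 0 := by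
  rw [pow_two] at hg
  refine Submodule.mul_induction_on hg ?_ ?_
  · intro a ha b hb
    rw [gradAt_mul, mem_mP.1 ha, mem_mP.1 hb]; simp
  · intro a b ha hb
    rw [map_add, ha, hb, add_zero]

theorem taylor_one {k : Type} [Field k] {n : ℕ} (p : Fin n → k)
    (g : MvPolynomial (Fin n) k) :
    g - C (eval p g) - linAt p (gradAt p g) ∈ mP p ^ 2 := by
  induction g using MvPolynomial.induction_on with
  | C a =>
    have : gradAt p (C a) = 0 := by ext j; simp [gradAt_apply]
    simp [this]
  | add f g hf hg =>
    have := add_mem hf hg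
    convert this using 1
    simp only [map_add]
    ring
  | mul_X g i ih =>
    have hX : gradAt p (X i) = Pi.single i 1 := by
      ext j; simp [gradAt_apply, pderiv_X, Pi.single_apply, eq_comm, apply_ite]
    have h2 : (g - C (eval p g)) * (X i - C (p i)) ∈ mP p ^ 2 := by
      rw [pow_two]
      exact Ideal.mul_mem_mul (by simp [mem_mP]) (by simp [mem_mP])
    have := add_mem (Ideal.mul_mem_left _ (C (p i)) ih) h2
    convert this using 1
    rw [gradAt_mul, map_add, map_smul, map_smul, hX, linAt_single]
    simp only [smul_eq_C_mul, map_mul, eval_X]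
    ring

theorem mP_eq_span {k : Type} [Field k] {n : ℕ} (p : Fin n → k) :
    mP p = Ideal.span (Set.range (linAt p)) := by
  apply le_antisymm
  · have key : ∀ g : MvPolynomial (Fin n) k,
        g - C (eval p g) ∈ Ideal.span (Set.range (linAt p)) := by
      intro g
      induction g using MvPolynomial.induction_on with
      | C a => simp
      | add f g hf hg =>
        convert add_mem hf hg using 1
        simp only [map_add]
        ring
      | mul_X g i ih =>
        have h2 : X i - C (p i) ∈ Ideal.span (Set.range (linAt p)) :=
          Ideal.subset_span ⟨_, linAt_single p i⟩
        convert add_mem (Ideal.mul_mem_left _ (C (p i)) ih) (Ideal.mul_mem_left _ g h2) using 1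
        simp only [map_mul, eval_X]
        ring
    intro g hg
    simpa [mem_mP.1 hg] using key g
  · rw [Ideal.span_le]
    rintro _ ⟨a, rfl⟩
    exact linAt_mem p a

theorem gradAt_ideal {k : Type} [Field k] {n s : ℕ} (p : Fin n → k)
    (f : Fin s → MvPolynomial (Fin n) k) (hf0 : ∀ i, eval p (f i) = 0)
    (g : MvPolynomial (Fin n) k) (hg : g ∈ Ideal.span (Set.range f)) :
    gradAt p g ∈ Submodule.span k (Set.range fun i => gradAt p (f i)) := by
  obtain ⟨c, rfl⟩ := (Submodule.mem_span_range_iff_exists_fun _).1 hg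
  rw [map_sum]
  refine Submodule.sum_mem _ fun i _ => ?_
  rw [smul_eq_mul, gradAt_mul, hf0, zero_smul, add_zero]
  exact Submodule.smul_mem _ _ (Submodule.subset_span ⟨i, rfl⟩)

open IsLocalRing in
theorem key_finrank {k : Type} [Field k] {n s : ℕ} (p : Fin n → k)
    (f : Fin s → MvPolynomial (Fin n) k) (hf0 : ∀ i, eval p (f i) = 0)
    {R : Type} [CommRing R] [IsLocalRing R] [Algebra k R]
    (ψ : MvPolynomial (Fin n) k →ₐ[k] R)
    (h1 : (mP p).map ψ = maximalIdeal R)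
    (h2 : ∀ g, ψ g ∈ maximalIdeal R ^ 2 →
      ∃ u, eval p u ≠ 0 ∧ u * g ∈ mP p ^ 2 ⊔ Ideal.span (Set.range f))
    (h3 : ∀ r : R, ∃ c : k, r - algebraMap k R c ∈ maximalIdeal R)
    (h4 : ∀ i, ψ (f i) = 0) :
    Module.finrank (ResidueField R) (CotangentSpace R) +
      (Matrix.of fun (i : Fin s) (j : Fin n) => eval p (pderiv j (f i))).rank = n := by
  have hmem : ∀ g ∈ mP p, ψ g ∈ maximalIdeal R := fun g hg => by
    rw [← h1]; exact Ideal.mem_map_of_mem _ hg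
  have hsq : ∀ g ∈ mP p ^ 2, ψ g ∈ maximalIdeal R ^ 2 := fun g hg => by
    rw [← h1, ← Ideal.map_pow]; exact Ideal.mem_map_of_mem _ hg
  let φ : (Fin n → k) →ₗ[k] CotangentSpace R :=
    ((maximalIdeal R).toCotangent.restrictScalars k) ∘ₗ
      LinearMap.codRestrict ((maximalIdeal R).restrictScalars k)
        (ψ.toLinearMap ∘ₗ linAt p) (fun a => hmem _ (linAt_mem p a))
  have hφ : ∀ a, φ a = (maximalIdeal R).toCotangent ⟨ψ (linAt p a), hmem _ (linAt_mem p a)⟩ :=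
    fun a => rfl
  have hker : LinearMap.ker φ = Submodule.span k (Set.range fun i => gradAt p (f i)) := by
    apply le_antisymm
    · intro a ha
      rw [LinearMap.mem_ker, hφ, Ideal.toCotangent_eq_zero] at ha
      obtain ⟨u, hu, hm⟩ := h2 _ ha
      obtain ⟨y, hy, z, hz, hyz⟩ := Submodule.mem_sup.1 hm
      have := congrArg (gradAt p) hyz
      rw [map_add, gradAt_sq p y hy, zero_add, gradAt_mul, gradAt_linAt,
        mem_mP.1 (linAt_mem p a), zero_smul, add_zero] at this
      have h := gradAt_ideal p f hf0 z hz
      rw [this] at h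
      exact (Submodule.smul_mem_iff _ hu).1 h
    · rw [Submodule.span_le]
      rintro _ ⟨i, rfl⟩
      rw [SetLike.mem_coe, LinearMap.mem_ker, hφ, Ideal.toCotangent_eq_zero]
      have := hsq _ (taylor_one p (f i))
      rw [hf0, map_zero, sub_zero, map_sub, h4, zero_sub] at this
      exact neg_mem_iff.1 this
  have hres : ∀ (r : R) (v : CotangentSpace R), ∃ c : k, r • v = c • v := fun r v => by
    obtain ⟨c, hc⟩ := h3 r
    refine ⟨c, ?_⟩
    have := Ideal.Cotangent.smul_eq_zero_of_mem hc v
    rw [sub_smul, sub_eq_zero] at this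
    rw [this, algebraMap_smul]
  have hrange : LinearMap.range φ = ⊤ := by
    rw [eq_top_iff]
    rintro v -
    obtain ⟨⟨x, hx⟩, rfl⟩ := Ideal.toCotangent_surjective _ v
    have hx' := hx
    rw [← h1, mP_eq_span, Ideal.map_span] at hx'
    have : ∀ x ∈ Ideal.span (ψ '' Set.range (linAt p)), ∃ hx : x ∈ maximalIdeal R,
        (maximalIdeal R).toCotangent ⟨x, hx⟩ ∈ LinearMap.range φ := by
      intro x hx
      induction hx using Submodule.span_induction with
      | mem x h =>
        obtain ⟨_, ⟨a, rfl⟩, rfl⟩ := h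
        exact ⟨hmem _ (linAt_mem p a), a, hφ a⟩
      | zero => exact ⟨zero_mem _, 0, by rw [map_zero]; exact (map_zero _).symm⟩
      | add x y _ _ ihx ihy =>
        obtain ⟨hx, hx'⟩ := ihx
        obtain ⟨hy, hy'⟩ := ihy
        exact ⟨add_mem hx hy, by
          have := add_mem hx' hy'
          rw [← map_add] at this
          exact this⟩
      | smul r x _ ih =>
        obtain ⟨hx, hx'⟩ := ih
        obtain ⟨c, hc⟩ := hres r ((maximalIdeal R).toCotangent ⟨x, hx⟩)
        refine ⟨Ideal.mul_mem_left _ _ hx, ?_⟩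
        have := Submodule.smul_mem _ c hx'
        rw [← hc, ← map_smul] at this
        exact this
    exact (this x hx').2
  have hone : Module.finrank k (ResidueField R) = 1 := by
    rw [finrank_eq_one_iff_of_nonzero' (1 : ResidueField R) one_ne_zero]
    intro w
    obtain ⟨r, rfl⟩ := residue_surjective w
    obtain ⟨c, hc⟩ := h3 r
    refine ⟨c, ?_⟩
    rw [← residue_eq_zero_iff, map_sub, sub_eq_zero] at hc
    rw [hc, ← Algebra.algebraMap_eq_smul_one]
    rfl
  have : IsScalarTower k (ResidueField R) (CotangentSpace R) := by
    refine IsScalarTower.of_algebraMap_smul fun c v => ?_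
    rw [IsScalarTower.algebraMap_apply k R (ResidueField R), algebraMap_smul, algebraMap_smul]
  have hfr : Module.finrank k (CotangentSpace R) =
      Module.finrank (ResidueField R) (CotangentSpace R) := by
    rw [← Module.finrank_mul_finrank k (ResidueField R) (CotangentSpace R), hone, one_mul]
  have hrn := LinearMap.finrank_range_add_finrank_ker φ
  rw [hrange, finrank_top, hker, hfr, Module.finrank_fin_fun] at hrn
  rw [Matrix.rank_eq_finrank_span_row]
  have hrow : (Matrix.of fun (i : Fin s) (j : Fin n) => eval p (pderiv j (f i))).row =
      fun i => gradAt p (f i) := by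
    funext i j
    rw [gradAt_apply]
    rfl
  rw [hrow]
  exact hrn

theorem loc_finrank {k : Type} [Field k] {n s : ℕ}
    (f : Fin s → MvPolynomial (Fin n) k) (p : Fin n → k)
    (hf0 : ∀ i, eval p (f i) = 0) (I : Ideal (MvPolynomial (Fin n) k))
    (hI : I = Ideal.span (Set.range f)) (hle : I ≤ mP p)
    (q : Ideal (MvPolynomial (Fin n) k ⧸ I)) (hq : q = Ideal.map (Ideal.Quotient.mk I) (mP p))
    [q.IsPrime] (L : Type) [CommRing L] [IsLocalRing L] [Algebra (MvPolynomial (Fin n) k ⧸ I) L]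
    [Algebra k L] [IsScalarTower k (MvPolynomial (Fin n) k ⧸ I) L]
    [IsLocalization.AtPrime L q] :
    Module.finrank (IsLocalRing.ResidueField L) (IsLocalRing.CotangentSpace L) +
      (Matrix.of fun (i : Fin s) (j : Fin n) => eval p (pderiv j (f i))).rank = n := by
  have hmkq : ∀ g, Ideal.Quotient.mk I g ∈ q ↔ eval p g = 0 := fun g => by
    rw [hq, ← mem_mP, ← Ideal.mem_comap,
      Ideal.comap_map_of_surjective _ Ideal.Quotient.mk_surjective, ← RingHom.ker_eq_comap_bot,
      Ideal.mk_ker, sup_eq_left.mpr hle]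
  have hmax : q.map (algebraMap _ L) =
      IsLocalRing.maximalIdeal L :=
    IsLocalization.AtPrime.map_eq_maximalIdeal q L
  exact key_finrank p f hf0 (R := L)
    ((Algebra.algHom k _ L).comp (Ideal.Quotient.mkₐ k I))
    (by
      rw [← hmax, hq, Ideal.map_map]
      rfl)
    (by
      intro g hg
      change algebraMap (MvPolynomial (Fin n) k ⧸ I) _ (Ideal.Quotient.mk I g) ∈ _ at hg
      rw [← hmax, ← Ideal.map_pow,
        IsLocalization.algebraMap_mem_map_algebraMap_iff q.primeCompl] at hg
      obtain ⟨u, hu, hug⟩ := hg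
      obtain ⟨u, rfl⟩ := Ideal.Quotient.mk_surjective u
      refine ⟨u, fun h => hu ((hmkq u).2 h), ?_⟩
      rw [hq, ← Ideal.map_pow, ← map_mul, ← Ideal.mem_comap,
        Ideal.comap_map_of_surjective _ Ideal.Quotient.mk_surjective, ← RingHom.ker_eq_comap_bot,
        Ideal.mk_ker] at hug
      rw [← hI]
      exact hug)
    (by
      intro r
      obtain ⟨a, b, rfl⟩ := IsLocalization.exists_mk'_eq q.primeCompl r
      obtain ⟨b, hb⟩ := b
      obtain ⟨g, rfl⟩ := Ideal.Quotient.mk_surjective a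
      obtain ⟨h, rfl⟩ := Ideal.Quotient.mk_surjective b
      have hh : eval p h ≠ 0 := fun e => hb ((hmkq h).2 e)
      refine ⟨eval p g / eval p h, ?_⟩
      have hu : IsUnit (algebraMap _ L (Ideal.Quotient.mk I h)) :=
        IsLocalization.map_units L (⟨_, hb⟩ : q.primeCompl)
      rw [← Ideal.unit_mul_mem_iff_mem _ hu, mul_sub, IsLocalization.mk'_spec'_mk,
        IsScalarTower.algebraMap_apply k (MvPolynomial (Fin n) k ⧸ I), ← map_mul, ← map_sub,
        ← hmax]
      refine Ideal.mem_map_of_mem _ ?_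
      have : algebraMap k (MvPolynomial (Fin n) k ⧸ I) (eval p g / eval p h) =
        Ideal.Quotient.mk I (C (eval p g / eval p h)) := rfl
      rw [this, ← map_mul, ← map_sub, hmkq]
      simp [mul_div_cancel₀, hh])
    (by
      intro i
      have : Ideal.Quotient.mk I (f i) = 0 :=
        Ideal.Quotient.eq_zero_iff_mem.2 (hI ▸ Ideal.subset_span ⟨i, rfl⟩)
      change algebraMap (MvPolynomial (Fin n) k ⧸ I) _ (Ideal.Quotient.mk I (f i)) = 0
      rw [this, map_zero])

/-- **Jacobian criterion at a rational point.** Let `I = ⟨f_1,…,f_s⟩` vanish at `p ∈ kⁿ`, and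
suppose the local ring of `A = k[x_1,…,x_n]/I` at the maximal ideal `m_p/I` has Krull dimension
`n - c`.  Then this local ring is regular if and only if the Jacobian matrix
`((∂f_i/∂x_j)(p))` has rank `c`. -/
theorem jacobian_criterion_at_rational_point {k : Type} [Field k] {n s c : ℕ} (hc : c ≤ n)
    (f : Fin s → MvPolynomial (Fin n) k) (p : Fin n → k)
    (hf0 : ∀ i, eval p (f i) = 0) :
    letI I := Ideal.span (Set.range f)
    letI hle : I ≤ mP p :=
      Ideal.span_le.mpr (Set.range_subset_iff.mpr fun i => RingHom.mem_ker.mpr (hf0 i))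
    letI := (qP_isMaximal p I hle).isPrime
    ringKrullDim (Localization.AtPrime (Ideal.map (Ideal.Quotient.mk I) (mP p))) =
        ((n - c : ℕ) : WithBot ℕ∞) →
      (IsRegularLocal (Localization.AtPrime (Ideal.map (Ideal.Quotient.mk I) (mP p))) ↔
        (Matrix.of fun (i : Fin s) (j : Fin n) => eval p (pderiv j (f i))).rank = c) := by
  intro hdim
  have hle : Ideal.span (Set.range f) ≤ mP p :=
    Ideal.span_le.mpr (Set.range_subset_iff.mpr fun i => RingHom.mem_ker.mpr (hf0 i))
  have hprime := (qP_isMaximal p _ hle).isPrime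
  have key := loc_finrank f p hf0 _ rfl hle _ rfl
    (Localization.AtPrime (Ideal.map (Ideal.Quotient.mk (Ideal.span (Set.range f))) (mP p)))
  unfold IsRegularLocal
  rw [hdim]
  norm_cast
  omega
end

section
/- Let k be a field and let A be a smooth k-algebra of finite type. Then A is locally a (standard smooth) complete intersection: there exist elements g_1,…,g_m ∈ A generating the unit ideal such that for each i the localization A_{g_i} is a standard smooth k-algebra, i.e., admits a presentation as a localization of a polynomial ring modulo a regular transversal system of equations whose Jacobian determinant is invertible. -/
/-- A smooth algebra of finite type over a field is locally standard smooth: there are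
elements `g_1,…,g_m` generating the unit ideal such that each localization `A_{g_i}` is a
standard smooth `k`-algebra (a localization of a polynomial ring modulo a transversal system
of equations with invertible Jacobian determinant). -/
theorem smooth_is_locally_standard_smooth {k A : Type} [Field k] [CommRing A] [Algebra k A]
    [Algebra.FiniteType k A] [Algebra.Smooth k A] :
    ∃ (m : ℕ) (g : Fin m → A), Ideal.span (Set.range g) = ⊤ ∧
      ∀ i, letI : Algebra k (Localization.Away (g i)) :=
          ((algebraMap A (Localization.Away (g i))).comp (algebraMap k A)).toAlgebra
        Algebra.IsStandardSmooth.{0, 0} k (Localization.Away (g i)) := by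
  have hf : (algebraMap k A).Smooth := by
    rw [RingHom.smooth_algebraMap]; infer_instance
  obtain ⟨s, hs, h⟩ := hf.locally_isStandardSmooth
  obtain ⟨t, hts, ht⟩ := (Ideal.span_eq_top_iff_finite s).mp hs
  refine ⟨t.card, fun i => (t.equivFin.symm i : A), ?_, fun i => ?_⟩
  · rw [← ht]
    congr 1
    ext x
    simp only [Set.mem_range, Finset.mem_coe]
    constructor
    · rintro ⟨i, rfl⟩
      exact (t.equivFin.symm i).2
    · intro hx
      exact ⟨t.equivFin ⟨x, hx⟩, by simp⟩
  · exact h _ (hts (t.equivFin.symm i).2)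
end
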